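/- Let p ≥ 1, s ≥ 2, and q ≥ 0 be integers. Then the rewriting system on the three-letter alphabet {a,b,x} with rules: a^p b^s → x, x b^q x → b, x b^{q+1} → b^{q+1} x, is confluent and terminating, and the monoid it presents is isomorphic to Mon⟨a,b : a^p b^{q+s} a^{p} b^s = b⟩. -/

import Mathlib

open Relation FreeMonoid

/-- Words over the alphabet `A`: the free monoid on `A`. -/
abbrev Word (A : Type) : Type := FreeMonoid A

/-- One-step rewriting relation of the rewriting system `R`. -/
def OneStep {A : Type} (R : Set (Word A × Word A)) (x y : Word A) : Prop :=
  ∃ u v l r : Word A, (l, r) ∈ R ∧ x = u * l * v ∧ y = u * r * v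

/-- Confluence of the rewriting system `R`. -/
def IsConfluent {A : Type} (R : Set (Word A × Word A)) : Prop :=
  ∀ w x y : Word A, ReflTransGen (OneStep R) w x → ReflTransGen (OneStep R) w y →
    ∃ z : Word A, ReflTransGen (OneStep R) x z ∧ ReflTransGen (OneStep R) y z

/-- Termination of the rewriting system `R`: no infinite rewriting chain. -/
def IsTerminating {A : Type} (R : Set (Word A × Word A)) : Prop :=
  ¬ ∃ f : ℕ → Word A, ∀ n : ℕ, OneStep R (f n) (f (n + 1))

/-- The monoid presented by generators `A` and relations `R`: the quotient of the
free monoid on `A` by the congruence generated by `R`. -/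
abbrev MonPres {A : Type} (R : Set (Word A × Word A)) : Type :=
  (conGen fun x y : Word A => (x, y) ∈ R).Quotient

/-- The canonical projection from words to the presented monoid. -/
def presMk {A : Type} (R : Set (Word A × Word A)) : Word A →* MonPres R :=
  Con.mk' _

/-- A two-letter alphabet. -/
inductive AB : Type | a | b

/-- A three-letter alphabet. -/
inductive ABX : Type | a | b | x


section Rewriting

variable {A : Type} {R : Set (Word A × Word A)}

theorem OneStep.of_mem {l r : Word A} (h : (l, r) ∈ R) (v : Word A) :
    OneStep R (l * v) (r * v) :=
  ⟨1, v, l, r, h, by rw [one_mul], by rw [one_mul]⟩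

theorem OneStep.mul_left {x y : Word A} (h : OneStep R x y) (t : Word A) :
    OneStep R (t * x) (t * y) := by
  obtain ⟨u, v, l, r, hlr, rfl, rfl⟩ := h
  exact ⟨t * u, v, l, r, hlr, by simp only [mul_assoc], by simp only [mul_assoc]⟩

theorem reflTransGen_oneStep_mul_left {x y : Word A} (h : ReflTransGen (OneStep R) x y)
    (t : Word A) : ReflTransGen (OneStep R) (t * x) (t * y) :=
  h.lift (t * ·) fun _ _ h => h.mul_left t

theorem isConfluent_of_normalForm (nf : Word A → Word A)
    (hred : ∀ w, ReflTransGen (OneStep R) w (nf w))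
    (hinv : ∀ x y, OneStep R x y → nf x = nf y) : IsConfluent R := by
  have key : ∀ w x, ReflTransGen (OneStep R) w x → nf w = nf x := by
    intro w x h
    induction h with
    | refl => rfl
    | tail _ h ih => exact ih.trans (hinv _ _ h)
  intro w x y hx hy
  refine ⟨nf w, ?_, ?_⟩
  · rw [key w x hx]; exact hred x
  · rw [key w y hy]; exact hred y

theorem isTerminating_of_measure (μ : Word A → ℕ)
    (h : ∀ x y, OneStep R x y → μ y < μ x) : IsTerminating R := by
  rintro ⟨f, hf⟩
  have hbound : ∀ n, μ (f n) + n ≤ μ (f 0) := by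
    intro n
    induction n with
    | zero => simp
    | succ n ih => have := h _ _ (hf n); omega
  have := hbound (μ (f 0) + 1)
  omega

/-- A word acts on states letter by letter, its last letter first. -/
theorem toList_mul_foldr {S : Type} (act : A → S → S) (u v : Word A) (t : S) :
    (toList (u * v)).foldr act t = (toList u).foldr act ((toList v).foldr act t) := by
  rw [toList_mul, List.foldr_append]

theorem toList_of_pow (c : A) (n : ℕ) : toList (of c ^ n) = List.replicate n c := by
  induction n with
  | zero => rfl
  | succ n ih => rw [pow_succ', toList_mul, ih, toList_of, List.replicate_succ]; rfl

/-- Invariance of the action of words on a set of states follows from that of the rules. -/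
theorem OneStep.foldr_eq {S : Type} {act : A → S → S} {P : S → Prop}
    (hP : ∀ c t, P t → P (act c t))
    (hR : ∀ l r, (l, r) ∈ R → ∀ t, P t → (toList l).foldr act t = (toList r).foldr act t)
    {x y : Word A} (h : OneStep R x y) {t : S} (ht : P t) :
    (toList x).foldr act t = (toList y).foldr act t := by
  obtain ⟨u, v, l, r, hlr, rfl, rfl⟩ := h
  have hv : P ((toList v).foldr act t) := by
    induction toList v with
    | nil => exact ht
    | cons c w ih => exact hP c _ ih
  rw [toList_mul_foldr, toList_mul_foldr, toList_mul_foldr, toList_mul_foldr, hR l r hlr _ hv]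

theorem OneStep.foldr_lt {act : A → ℕ → ℕ} (hact : ∀ c, StrictMono (act c))
    (hR : ∀ l r, (l, r) ∈ R → ∀ t, (toList r).foldr act t < (toList l).foldr act t)
    {x y : Word A} (h : OneStep R x y) (t : ℕ) :
    (toList y).foldr act t < (toList x).foldr act t := by
  obtain ⟨u, v, l, r, hlr, rfl, rfl⟩ := h
  rw [toList_mul_foldr, toList_mul_foldr, toList_mul_foldr, toList_mul_foldr]
  have := hR l r hlr ((toList v).foldr act t)
  induction toList u with
  | nil => exact this
  | cons c w ih => exact hact c ih

theorem reflTransGen_oneStep_foldr {act : A → List A → List A}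
    (hact : ∀ c t, ReflTransGen (OneStep R) (of c * ofList t) (ofList (act c t))) (w : Word A) :
    ReflTransGen (OneStep R) w (ofList ((toList w).foldr act [])) := by
  induction w using FreeMonoid.recOn with
  | one => exact ReflTransGen.refl
  | of_mul c w ih => exact (reflTransGen_oneStep_mul_left ih (of c)).trans (hact c _)

end Rewriting

section System

open List

/-- The system with rules `a^p b^s → x`, `x b^q x → b`, `x b^(q+1) → b^(q+1) x`. -/
abbrev rulesABX (p s q : ℕ) : Set (Word ABX × Word ABX) :=
  {((of ABX.a)^p * (of ABX.b)^s, of ABX.x),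
   ((of ABX.x) * (of ABX.b)^q * (of ABX.x), of ABX.b),
   ((of ABX.x) * (of ABX.b)^(q+1), (of ABX.b)^(q+1) * (of ABX.x))}

/-- The relation `a^p b^(q+s) a^p b^s = b`. -/
abbrev rulesAB (p s q : ℕ) : Set (Word AB × Word AB) :=
  {((of AB.a)^p * (of AB.b)^(q+s) * (of AB.a)^p * (of AB.b)^s, of AB.b)}

/-- Interpretation of the letters as functions on `ℕ` that the rules strictly decrease. -/
def weight : ABX → ℕ → ℕ
  | .a, n => 2 * n + 1
  | .b, n => n + 1
  | .x, n => 2 * n + 1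

theorem weight_strictMono (c : ABX) : StrictMono (weight c) := by
  intro m n h
  cases c <;> simp only [weight] <;> omega

theorem foldr_weight_b (k n : ℕ) : (replicate k ABX.b).foldr weight n = n + k := by
  induction k with
  | zero => rfl
  | succ k ih => rw [replicate_succ, foldr_cons, ih]; simp only [weight]; omega

theorem le_foldr_weight_a (k n : ℕ) : n ≤ (replicate k ABX.a).foldr weight n := by
  induction k with
  | zero => exact le_rfl
  | succ k ih => rw [replicate_succ, foldr_cons]; simp only [weight]; omega

theorem isTerminating_rulesABX {p s : ℕ} (q : ℕ) (hp : 1 ≤ p) (hs : 2 ≤ s) :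
    IsTerminating (rulesABX p s q) := by
  refine isTerminating_of_measure (fun w => (toList w).foldr weight 0) fun x y h =>
    h.foldr_lt weight_strictMono ?_ 0
  intro l r hlr t
  simp only [rulesABX, Set.mem_insert_iff, Set.mem_singleton_iff, Prod.mk.injEq] at hlr
  obtain ⟨rfl, rfl⟩ | ⟨rfl, rfl⟩ | ⟨rfl, rfl⟩ := hlr
  · obtain ⟨k, rfl⟩ := Nat.exists_eq_add_of_le' hp
    have := le_foldr_weight_a k (t + s)
    simp only [toList_mul, toList_of_pow, toList_of, foldr_append, foldr_cons, foldr_nil,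
      foldr_weight_b, replicate_succ, weight]
    omega
  · simp only [toList_mul, toList_of_pow, toList_of, foldr_append, foldr_cons, foldr_nil,
      foldr_weight_b, weight]
    omega
  · simp only [toList_mul, toList_of_pow, toList_of, foldr_append, foldr_cons, foldr_nil,
      foldr_weight_b, weight]
    omega

open Classical in
/-- Left multiplication by `x` on normal forms. -/
noncomputable def mulX (q : ℕ) (w : List ABX) : List ABX :=
  if replicate q ABX.b ++ [ABX.x] <+: w then ABX.b :: w.drop (q + 1)
  else if _h : replicate (q + 1) ABX.b <+: w then
    replicate (q + 1) ABX.b ++ mulX q (w.drop (q + 1))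
  else ABX.x :: w
termination_by w.length
decreasing_by
  have := _h.length_le
  simp only [length_replicate, length_drop] at this ⊢
  omega

theorem mulX_b_x (q : ℕ) (t : List ABX) :
    mulX q (replicate q ABX.b ++ ABX.x :: t) = ABX.b :: t := by
  rw [mulX, if_pos ⟨t, by simp⟩]
  simp [drop_append]

theorem mulX_b (q : ℕ) (t : List ABX) :
    mulX q (replicate (q + 1) ABX.b ++ t) = replicate (q + 1) ABX.b ++ mulX q t := by
  rw [mulX, if_neg, dif_pos (prefix_append _ _)]
  · simp
  · rw [replicate_succ', append_assoc, prefix_append_right_inj]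
    simp

theorem mulX_cases (q : ℕ) (w : List ABX) :
    (∃ t, w = replicate q ABX.b ++ ABX.x :: t) ∨ (∃ t, w = replicate (q + 1) ABX.b ++ t) ∨
      mulX q w = ABX.x :: w := by
  by_cases h₁ : replicate q ABX.b ++ [ABX.x] <+: w
  · obtain ⟨t, rfl⟩ := h₁
    exact .inl ⟨t, by simp⟩
  by_cases h₂ : replicate (q + 1) ABX.b <+: w
  · obtain ⟨t, rfl⟩ := h₂
    exact .inr (.inl ⟨t, rfl⟩)
  · exact .inr (.inr (by rw [mulX, if_neg h₁, dif_neg h₂]))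

open Classical in
/-- Left multiplication by a letter on normal forms. -/
noncomputable def mulLetter (p s q : ℕ) : ABX → List ABX → List ABX
  | .a, w => if replicate (p - 1) ABX.a ++ replicate s ABX.b <+: w then
      mulX q (w.drop (p - 1 + s)) else ABX.a :: w
  | .b, w => ABX.b :: w
  | .x, w => mulX q w

/-- No occurrence of `x` in the word starts a left-hand side. -/
def XReduced (q : ℕ) (w : List ABX) : Prop :=
  ∀ t, ABX.x :: t <:+ w → mulX q t = ABX.x :: t

theorem XReduced.of_suffix {q : ℕ} {v w : List ABX} (hw : XReduced q w) (h : v <:+ w) :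
    XReduced q v :=
  fun t ht => hw t (ht.trans h)

theorem XReduced.cons {q : ℕ} {w : List ABX} (hw : XReduced q w) {c : ABX} (hc : c ≠ ABX.x) :
    XReduced q (c :: w) := by
  intro t ht
  rcases suffix_cons_iff.1 ht with h | h
  · exact absurd (cons.inj h).1.symm hc
  · exact hw t h

theorem XReduced.replicate_b_append {q : ℕ} {w : List ABX} (hw : XReduced q w) (k : ℕ) :
    XReduced q (replicate k ABX.b ++ w) := by
  induction k with
  | zero => exact hw
  | succ k ih => rw [replicate_succ, cons_append]; exact ih.cons (by simp)

theorem XReduced.mulX {q : ℕ} {w : List ABX} (hw : XReduced q w) : XReduced q (mulX q w) := by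
  induction hn : w.length using Nat.strong_induction_on generalizing w with
  | _ n ih =>
    obtain ⟨t, rfl⟩ | ⟨t, rfl⟩ | h := mulX_cases q w
    · rw [mulX_b_x]
      exact (hw.of_suffix ⟨replicate q ABX.b ++ [ABX.x], by simp⟩).cons (by simp)
    · rw [mulX_b]
      refine XReduced.replicate_b_append ?_ _
      exact ih _ (by simp at hn; omega) (hw.of_suffix (suffix_append _ _)) rfl
    · rw [h]
      intro t ht
      rcases suffix_cons_iff.1 ht with hx | hx
      · rw [(cons.inj hx).2, h]
      · exact hw t hx

theorem XReduced.mulLetter {q : ℕ} (p s : ℕ) (c : ABX) {w : List ABX} (hw : XReduced q w) :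
    XReduced q (mulLetter p s q c w) := by
  cases c with
  | a =>
    rw [_root_.mulLetter]
    split_ifs
    · exact (hw.of_suffix (drop_suffix _ _)).mulX
    · exact hw.cons (by simp)
  | b => exact hw.cons (by simp)
  | x => exact hw.mulX

theorem mulX_b_mulX {q : ℕ} {w : List ABX} (hw : XReduced q w) :
    mulX q (replicate q ABX.b ++ mulX q w) = ABX.b :: w := by
  induction hn : w.length using Nat.strong_induction_on generalizing w with
  | _ n ih =>
    obtain ⟨t, rfl⟩ | ⟨t, rfl⟩ | h := mulX_cases q w
    · have ht : mulX q t = ABX.x :: t := hw t (suffix_append _ _)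
      have := mulX_b q t
      rw [replicate_succ', append_assoc] at this
      rw [mulX_b_x]
      refine this.trans ?_
      rw [ht, ← replicate_succ', replicate_succ, cons_append]
    · have := mulX_b q (replicate q ABX.b ++ mulX q t)
      rw [mulX_b, ← append_assoc, replicate_append_replicate, Nat.add_comm q,
        ← replicate_append_replicate, append_assoc, this,
        ih _ (by simp at hn; omega) (hw.of_suffix (suffix_append _ _)) rfl,
        ← cons_append, ← replicate_succ, replicate_succ' (n := q + 1)]
      simp
    · rw [h, mulX_b_x]

theorem foldr_mulLetter_b (p s q k : ℕ) (w : List ABX) :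
    (replicate k ABX.b).foldr (mulLetter p s q) w = replicate k ABX.b ++ w := by
  induction k with
  | zero => rfl
  | succ k ih => rw [replicate_succ, foldr_cons, ih]; rfl

theorem foldr_mulLetter_a {p s k : ℕ} (q : ℕ) (hs : 1 ≤ s) (hk : k < p) (w : List ABX) :
    (replicate k ABX.a).foldr (mulLetter p s q) (replicate s ABX.b ++ w) =
      replicate k ABX.a ++ (replicate s ABX.b ++ w) := by
  obtain ⟨s, rfl⟩ := Nat.exists_eq_add_of_le' hs
  induction k with
  | zero => rfl
  | succ k ih =>
    rw [replicate_succ (n := k), foldr_cons, ih (by omega), mulLetter, if_neg]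
    · rfl
    · obtain ⟨d, hd⟩ : ∃ d, p - 1 = k + (d + 1) := ⟨p - 1 - k - 1, by omega⟩
      rw [hd, ← replicate_append_replicate, append_assoc, prefix_append_right_inj]
      simp [replicate_succ]

theorem foldr_mulLetter_rule {p s q : ℕ} (hp : 1 ≤ p) (hs : 1 ≤ s) (l r : Word ABX)
    (hlr : (l, r) ∈ rulesABX p s q) (t : List ABX) (ht : XReduced q t) :
    (toList l).foldr (mulLetter p s q) t = (toList r).foldr (mulLetter p s q) t := by
  simp only [rulesABX, Set.mem_insert_iff, Set.mem_singleton_iff, Prod.mk.injEq] at hlr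
  obtain ⟨rfl, rfl⟩ | ⟨rfl, rfl⟩ | ⟨rfl, rfl⟩ := hlr
  · obtain ⟨k, rfl⟩ := Nat.exists_eq_add_of_le' hp
    simp only [toList_mul, toList_of_pow, toList_of, foldr_append, foldr_cons, foldr_nil,
      foldr_mulLetter_b, replicate_succ]
    rw [foldr_mulLetter_a q hs (Nat.lt_succ_self k), mulLetter, if_pos ⟨t, by simp⟩]
    simp [drop_append, mulLetter]
  · simp only [toList_mul, toList_of_pow, toList_of, foldr_append, foldr_cons, foldr_nil,
      foldr_mulLetter_b, mulLetter]
    exact mulX_b_mulX ht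
  · simp only [toList_mul, toList_of_pow, toList_of, foldr_append, foldr_cons, foldr_nil,
      foldr_mulLetter_b, mulLetter]
    exact mulX_b q t

theorem ofList_replicate (c : ABX) (k : ℕ) : ofList (replicate k c) = of c ^ k := by
  rw [← toList_of_pow, ofList_toList]

theorem reflTransGen_mulX (p s q : ℕ) (w : List ABX) :
    ReflTransGen (OneStep (rulesABX p s q)) (of ABX.x * ofList w) (ofList (mulX q w)) := by
  induction hn : w.length using Nat.strong_induction_on generalizing w with
  | _ n ih =>
    obtain ⟨t, rfl⟩ | ⟨t, rfl⟩ | h := mulX_cases q w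
    · have := OneStep.of_mem (R := rulesABX p s q) (.inr (.inl rfl)) (ofList t)
      rw [mulX_b_x, ofList_append, ofList_cons, ofList_cons, ofList_replicate]
      simp only [mul_assoc] at this
      exact .single this
    · have := OneStep.of_mem (R := rulesABX p s q) (.inr (.inr rfl)) (ofList t)
      rw [mulX_b, ofList_append, ofList_append, ofList_replicate]
      simp only [mul_assoc] at this
      exact .head this (reflTransGen_oneStep_mul_left (ih _ (by simp at hn; omega) t rfl) _)
    · rw [h]; exact .refl

theorem reflTransGen_mulLetter {p : ℕ} (s q : ℕ) (hp : 1 ≤ p) (c : ABX) (w : List ABX) :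
    ReflTransGen (OneStep (rulesABX p s q)) (of c * ofList w)
      (ofList (mulLetter p s q c w)) := by
  cases c with
  | a =>
    rw [mulLetter]
    split_ifs with h
    · obtain ⟨t, rfl⟩ := h
      have := OneStep.of_mem (R := rulesABX p s q) (.inl rfl) (ofList t)
      have hd : (replicate (p - 1) ABX.a ++ replicate s ABX.b ++ t).drop (p - 1 + s) = t :=
        drop_left' (by simp)
      rw [hd, ofList_append, ofList_append, ofList_replicate, ofList_replicate, ← mul_assoc,
        ← mul_assoc, ← pow_succ', Nat.sub_add_cancel hp]
      exact .head this (reflTransGen_mulX p s q t)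
    · exact .refl
  | b => exact .refl
  | x => exact reflTransGen_mulX p s q w

theorem isConfluent_rulesABX {p s : ℕ} (q : ℕ) (hp : 1 ≤ p) (hs : 1 ≤ s) :
    IsConfluent (rulesABX p s q) :=
  isConfluent_of_normalForm (fun w => ofList ((toList w).foldr (mulLetter p s q) []))
    (reflTransGen_oneStep_foldr (reflTransGen_mulLetter s q hp))
    fun _ _ h => congrArg ofList <| h.foldr_eq (P := XReduced q)
      (fun c _ ht => ht.mulLetter p s c) (foldr_mulLetter_rule hp hs) (fun t ht => by simp at ht)

theorem presMk_eq {A : Type} {R : Set (Word A × Word A)} {l r : Word A} (h : (l, r) ∈ R) :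
    presMk R l = presMk R r :=
  (Con.eq _).2 (ConGen.Rel.of _ _ h)

/-- The homomorphism out of a presented monoid determined by the images of the generators. -/
def presLift {A M : Type} [Monoid M] (R : Set (Word A × Word A)) (f : Word A →* M)
    (hf : ∀ l r, (l, r) ∈ R → f l = f r) : MonPres R →* M :=
  Con.lift _ f (Con.conGen_le.2 hf)

theorem presLift_presMk {A M : Type} [Monoid M] (R : Set (Word A × Word A)) (f : Word A →* M)
    (hf : ∀ l r, (l, r) ∈ R → f l = f r) (w : Word A) : presLift R f hf (presMk R w) = f w :=
  rfl

theorem monPres_hom_ext {A M : Type} [Monoid M] {R : Set (Word A × Word A)}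
    {f g : MonPres R →* M} (h : ∀ c, f (presMk R (of c)) = g (presMk R (of c))) : f = g :=
  Con.hom_ext (FreeMonoid.hom_eq h)

/-- Images of the generators under the map eliminating `x`. -/
def elimX (p s q : ℕ) : ABX → MonPres (rulesAB p s q)
  | .a => presMk _ (of AB.a)
  | .b => presMk _ (of AB.b)
  | .x => presMk _ (of AB.a) ^ p * presMk _ (of AB.b) ^ s

/-- Images of the generators under the inclusion of alphabets. -/
def inclAB (p s q : ℕ) : AB → MonPres (rulesABX p s q)
  | .a => presMk _ (of ABX.a)
  | .b => presMk _ (of ABX.b)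

theorem commute_of_mul_pow_mul {M : Type} [Monoid M] {x b : M} {q : ℕ} (h : x * b ^ q * x = b) :
    x * b ^ (q + 1) = b ^ (q + 1) * x := by
  calc x * b ^ (q + 1) = x * b ^ q * (x * b ^ q * x) := by rw [h, pow_succ, mul_assoc]
    _ = x * b ^ q * x * b ^ q * x := by simp only [mul_assoc]
    _ = b ^ (q + 1) * x := by rw [h, ← pow_succ']

theorem elimX_rule (p s q : ℕ) (l r : Word ABX) (hlr : (l, r) ∈ rulesABX p s q) :
    FreeMonoid.lift (elimX p s q) l = FreeMonoid.lift (elimX p s q) r := by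
  have hx : elimX p s q .x * elimX p s q .b ^ q * elimX p s q .x = elimX p s q .b := by
    have := presMk_eq (R := rulesAB p s q) rfl
    simp only [map_mul, map_pow] at this
    simp only [elimX]
    rw [Nat.add_comm q s, pow_add] at this
    simpa only [mul_assoc] using this
  simp only [rulesABX, Set.mem_insert_iff, Set.mem_singleton_iff, Prod.mk.injEq] at hlr
  obtain ⟨rfl, rfl⟩ | ⟨rfl, rfl⟩ | ⟨rfl, rfl⟩ := hlr
  · simp only [map_mul, map_pow, lift_eval_of]; rfl
  · simpa only [map_mul, map_pow, lift_eval_of] using hx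
  · simpa only [map_mul, map_pow, lift_eval_of] using commute_of_mul_pow_mul hx

theorem inclAB_rule (p s q : ℕ) (l r : Word AB) (hlr : (l, r) ∈ rulesAB p s q) :
    FreeMonoid.lift (inclAB p s q) l = FreeMonoid.lift (inclAB p s q) r := by
  have h₁ := presMk_eq (R := rulesABX p s q) (.inl rfl)
  have h₂ := presMk_eq (R := rulesABX p s q) (.inr (.inl rfl))
  simp only [map_mul, map_pow] at h₁ h₂
  simp only [rulesAB, Set.mem_singleton_iff, Prod.mk.injEq] at hlr
  obtain ⟨rfl, rfl⟩ := hlr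
  simp only [map_mul, map_pow, lift_eval_of, inclAB]
  rw [← h₁] at h₂
  rw [Nat.add_comm q s, pow_add]
  simpa only [mul_assoc] using h₂

/-- The monoid presented by `rulesABX` is the one presented by `rulesAB`. -/
def monPresEquiv (p s q : ℕ) : MonPres (rulesABX p s q) ≃* MonPres (rulesAB p s q) :=
  MonoidHom.toMulEquiv (presLift _ _ (elimX_rule p s q)) (presLift _ _ (inclAB_rule p s q))
    (monPres_hom_ext fun c => by
      have h₁ := presMk_eq (R := rulesABX p s q) (.inl rfl)
      simp only [map_mul, map_pow] at h₁
      cases c <;> simp only [MonoidHom.comp_apply, presLift_presMk, lift_eval_of, elimX, map_mul,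
        map_pow, inclAB, MonoidHom.id_apply]
      exact h₁)
    (monPres_hom_ext fun c => by cases c <;> rfl)

end System

/-- Case 3 (`s > 1`, `r = 0`, `k = 1`) of Theorem 3.1: the three-rule system on `{a,b,x}` is
complete and presents `Mon⟨a,b : a^p b^(q+s) a^p b^s = b⟩`. -/
theorem stmt4 (p s q : ℕ) (hp : 1 ≤ p) (hs : 2 ≤ s) :
    IsConfluent (({((of ABX.a)^p * (of ABX.b)^s, of ABX.x),
       ((of ABX.x) * (of ABX.b)^q * (of ABX.x), of ABX.b),
       ((of ABX.x) * (of ABX.b)^(q+1), (of ABX.b)^(q+1) * (of ABX.x))} : Set (Word ABX × Word ABX))) ∧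
    IsTerminating (({((of ABX.a)^p * (of ABX.b)^s, of ABX.x),
       ((of ABX.x) * (of ABX.b)^q * (of ABX.x), of ABX.b),
       ((of ABX.x) * (of ABX.b)^(q+1), (of ABX.b)^(q+1) * (of ABX.x))} : Set (Word ABX × Word ABX))) ∧
    Nonempty (MonPres (({((of ABX.a)^p * (of ABX.b)^s, of ABX.x),
       ((of ABX.x) * (of ABX.b)^q * (of ABX.x), of ABX.b),
       ((of ABX.x) * (of ABX.b)^(q+1), (of ABX.b)^(q+1) * (of ABX.x))} : Set (Word ABX × Word ABX))) ≃*
      MonPres ({((of AB.a)^p * (of AB.b)^(q+s) * (of AB.a)^p * (of AB.b)^s, of AB.b)} :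
        Set (Word AB × Word AB))) := by
  exact ⟨isConfluent_rulesABX q hp (by omega), isTerminating_rulesABX q hp hs, ⟨monPresEquiv p s q⟩⟩
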